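/- Let ∇ be a left (σ,τ)-connection on a left Σ-module M with derivations X_a, endomorphisms σ_a and module maps τ̂_a. Assume [σ_a, σ_b] = 0, [σ_a, X_b] = 0 (as operators on A), [τ̂_a, τ̂_b] = 0 and [τ̂_a, ∇_{X_b}] = 0 (as operators on M), and assume X_a ∘ X_b = X_b ∘ X_a. Then the operator Curv(X_a, X_b) = ∇_{X_a}∘∇_{X_b} − ∇_{X_b}∘∇_{X_a} satisfies Curv(X_a, X_b)(fm) = σ_a(σ_b(f))·Curv(X_a, X_b)(m) for all f ∈ A, m ∈ M. -/

import Mathlib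

/-- Under the commutation relations `[σ_a, σ_b] = [σ_a, X_b] = 0` on `A`,
`[τ̂_a, τ̂_b] = [τ̂_a, ∇_{X_b}] = 0` on `M`, and `X_a ∘ X_b = X_b ∘ X_a`,
the curvature `Curv(X_a, X_b) = ∇_{X_a}∘∇_{X_b} - ∇_{X_b}∘∇_{X_a}` of a left
`(σ,τ)`-connection satisfies the twisted linearity
`Curv(X_a,X_b)(f • m) = σ_a(σ_b(f)) • Curv(X_a,X_b)(m)`. -/
theorem stmt13 (A M : Type*) [Ring A] [Algebra ℂ A]
    [AddCommGroup M] [Module ℂ M] [Module A M]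
    (ι : Type*) (σ τ : ι → (A →ₐ[ℂ] A))
    (X : ι → A → A)
    (hXder : ∀ a (p q : A), X a (p * q) = σ a p * X a q + X a p * τ a q)
    (τh : ι → M →ₗ[ℂ] M)
    (hτh : ∀ a (p : A) (m : M), τh a (p • m) = τ a p • τh a m)
    (Conn : ι → M → M)
    (hadd : ∀ a (m m' : M), Conn a (m + m') = Conn a m + Conn a m')
    (hLeib : ∀ a (p : A) (m : M),
      Conn a (p • m) = σ a p • Conn a m + X a p • τh a m)
    (hσσ : ∀ a b (p : A), σ a (σ b p) = σ b (σ a p))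
    (hσX : ∀ a b (p : A), σ a (X b p) = X b (σ a p))
    (hττ : ∀ a b (m : M), τh a (τh b m) = τh b (τh a m))
    (hτConn : ∀ a b (m : M), τh a (Conn b m) = Conn b (τh a m))
    (hXX : ∀ a b (p : A), X a (X b p) = X b (X a p)) :
    ∀ a b (p : A) (m : M),
      (Conn a (Conn b (p • m)) - Conn b (Conn a (p • m))) =
        σ a (σ b p) • (Conn a (Conn b m) - Conn b (Conn a m)) := by
  intro a b p m
  have h1 : Conn a (Conn b (p • m)) = σ a (σ b p) • Conn a (Conn b m)
      + X a (σ b p) • Conn b (τh a m) + (X b (σ a p) • Conn a (τh b m)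
      + X a (X b p) • τh a (τh b m)) := by
    rw [hLeib b, hadd, hLeib a, hLeib a, hτConn a b, hσX a b]
  have h2 : Conn b (Conn a (p • m)) = σ a (σ b p) • Conn b (Conn a m)
      + X b (σ a p) • Conn a (τh b m) + (X a (σ b p) • Conn b (τh a m)
      + X a (X b p) • τh a (τh b m)) := by
    rw [hLeib a, hadd, hLeib b, hLeib b, hτConn b a, hσX b a, hσσ b a, hXX b a, hττ b a]
  rw [h1, h2, smul_sub]
  abel
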